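/- Let φ₁ := [[(1+i)/√2, 0],[0, (1−i)/√2]] ∈ GL₂(ℂ). Then φ₁ normalizes 2T and φ₁² ∈ 2T, so φ₁ acts on V_d^{2T} as an involution. For every even integer d ≥ 0, the multiplicities (m₊, m₋) of the eigenvalues +1 and −1 of φ₁ acting on V_d^{2T} are: (⌊d/24⌋ + 1, ⌊d/24⌋) if d ≡ 0 (mod 8); (⌊d/24⌋, ⌊d/24⌋ + 1) if d ≡ 6 (mod 8); (⌊d/24⌋, ⌊d/24⌋) if d ≡ 2, 4, or 10 (mod 24); and (⌊d/24⌋ + 1, ⌊d/24⌋ + 1) if d ≡ 12, 18, or 20 (mod 24). -/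

import Mathlib

open Matrix

/-- The substitution action of a (invertible) `2×2` matrix `g` on polynomials in two
variables: `(g · f)(v) = f (g⁻¹ v)`. -/
noncomputable def mact (A : Matrix (Fin 2) (Fin 2) ℂ) :
    MvPolynomial (Fin 2) ℂ →ₐ[ℂ] MvPolynomial (Fin 2) ℂ :=
  MvPolynomial.aeval fun i => ∑ j, A⁻¹ i j • MvPolynomial.X j

/-- `V_d^S`: the space of homogeneous polynomials of degree `d` in two variables invariant
under (the substitution action of) every matrix in `S`. -/
noncomputable def invariants (S : Set (Matrix (Fin 2) (Fin 2) ℂ)) (d : ℕ) :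
    Submodule ℂ (MvPolynomial (Fin 2) ℂ) :=
  (MvPolynomial.homogeneousSubmodule (Fin 2) ℂ d) ⊓
    ⨅ A ∈ S, LinearMap.eqLocus (mact A).toLinearMap LinearMap.id

/-- The quaternion matrix `I = [[i,0],[0,−i]]`. -/
noncomputable def Iq : Matrix (Fin 2) (Fin 2) ℂ := !![Complex.I, 0; 0, -Complex.I]

/-- The quaternion matrix `J = [[0,−1],[1,0]]`. -/
def Jq : Matrix (Fin 2) (Fin 2) ℂ := !![0, -1; 1, 0]

/-- The quaternion matrix `K = I·J`. -/
noncomputable def Kq : Matrix (Fin 2) (Fin 2) ℂ := Iq * Jq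

/-- The binary tetrahedral group `2T ⊆ SL₂(ℂ)`, as a set of 24 matrices:
`±1, ±I, ±J, ±K` and `(±1 ± I ± J ± K)/2`. -/
noncomputable def binTet : Set (Matrix (Fin 2) (Fin 2) ℂ) :=
  {1, -1, Iq, -Iq, Jq, -Jq, Kq, -Kq} ∪
    { M | ∃ a ∈ ({1, -1} : Set ℂ), ∃ b ∈ ({1, -1} : Set ℂ), ∃ c ∈ ({1, -1} : Set ℂ),
        ∃ e ∈ ({1, -1} : Set ℂ),
        M = (2 : ℂ)⁻¹ • (a • (1 : Matrix (Fin 2) (Fin 2) ℂ) + b • Iq + c • Jq + e • Kq) }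

/-- The matrix `φ₁ = [[(1+i)/√2, 0],[0,(1−i)/√2]]`. -/
noncomputable def phi1 : Matrix (Fin 2) (Fin 2) ℂ :=
  !![(1 + Complex.I) / (Real.sqrt 2 : ℂ), 0; 0, (1 - Complex.I) / (Real.sqrt 2 : ℂ)]


open MvPolynomial

local notation "PP" => MvPolynomial (Fin 2) ℂ

noncomputable def om : Matrix (Fin 2) (Fin 2) ℂ :=
  (2 : ℂ)⁻¹ • ((1 : Matrix (Fin 2) (Fin 2) ℂ) + Iq + Jq + Kq)

theorem mact_X (A B : Matrix (Fin 2) (Fin 2) ℂ) (h : A * B = 1) (i : Fin 2) :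
    mact A (X i) = C (B i 0) * X 0 + C (B i 1) * X 1 := by
  rw [mact, aeval_X, Matrix.inv_eq_right_inv h]
  simp [MvPolynomial.smul_eq_C_mul]

theorem mact_mul (A B : Matrix (Fin 2) (Fin 2) ℂ) (f : PP) :
    mact (A * B) f = mact A (mact B f) := by
  have : mact (A * B) = (mact A).comp (mact B) := by
    apply MvPolynomial.algHom_ext
    intro i
    simp only [mact, aeval_X, AlgHom.comp_apply, map_sum, map_smul, Matrix.mul_inv_rev,
      Matrix.mul_apply, Finset.sum_smul, Finset.smul_sum, smul_smul]
    rw [Finset.sum_comm]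
  rw [this]; rfl

theorem mact_hom (A : Matrix (Fin 2) (Fin 2) ℂ) {f : PP} {d : ℕ} (h : f.IsHomogeneous d) :
    (mact A f).IsHomogeneous d := by
  have := h.aeval (n := 1) (fun i => ∑ j, A⁻¹ i j • (X j : PP)) (fun i => by
    apply IsHomogeneous.sum
    intro j _
    rw [smul_eq_C_mul]
    exact isHomogeneous_C_mul_X _ _)
  simpa [mact] using this

theorem Kq_eq : Kq = !![0, -Complex.I; -Complex.I, 0] := by
  simp [Kq, Iq, Jq]

theorem om_eq : om = !![(1+Complex.I)/2, -(1+Complex.I)/2; (1-Complex.I)/2, (1-Complex.I)/2] := by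
  ext i j
  fin_cases i <;> fin_cases j <;> simp [om, Kq_eq, Iq, Jq] <;> ring

theorem Iinv : Iq * !![-Complex.I, 0; 0, Complex.I] = 1 := by
  ext i j
  fin_cases i <;> fin_cases j <;> simp [Iq]

theorem Jinv : Jq * !![0, 1; -1, 0] = 1 := by
  ext i j
  fin_cases i <;> fin_cases j <;> simp [Jq]

theorem ominv : om * !![(1-Complex.I)/2, (1+Complex.I)/2; -(1-Complex.I)/2, (1+Complex.I)/2] = 1 := by
  have := Complex.I_sq
  rw [om_eq]
  ext i j
  fin_cases i <;> fin_cases j <;> simp <;> grind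

noncomputable def zt : ℂ := (1 + Complex.I) / (Real.sqrt 2 : ℂ)
noncomputable def zt' : ℂ := (1 - Complex.I) / (Real.sqrt 2 : ℂ)

theorem sq2 : ((Real.sqrt 2 : ℝ) : ℂ) ^ 2 = 2 := by
  rw [← Complex.ofReal_pow, Real.sq_sqrt (by norm_num)]; simp

theorem sq2_ne : ((Real.sqrt 2 : ℝ) : ℂ) ≠ 0 := by
  intro h
  have := sq2
  rw [h] at this
  norm_num at this

theorem zt_sq : zt ^ 2 = Complex.I := by
  rw [zt, div_pow, sq2]
  have := Complex.I_sq
  grind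

theorem zt'_sq : zt' ^ 2 = -Complex.I := by
  rw [zt', div_pow, sq2]
  have := Complex.I_sq
  grind

theorem zt_mul : zt * zt' = 1 := by
  rw [zt, zt', div_mul_div_comm, ← sq, sq2]
  have := Complex.I_sq
  grind

theorem phi_eq : phi1 = !![zt, 0; 0, zt'] := rfl

theorem phinv : phi1 * !![zt', 0; 0, zt] = 1 := by
  have := zt_mul
  have h2 : zt' * zt = 1 := by rw [mul_comm]; exact this
  rw [phi_eq]
  ext i j
  fin_cases i <;> fin_cases j <;> simp [this, h2]

theorem phi_mul_inv : phi1 * phi1⁻¹ = 1 := by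
  rw [Matrix.inv_eq_right_inv phinv, phinv]

theorem phi_inv_mul : phi1⁻¹ * phi1 = 1 := by
  rw [mul_eq_one_comm]; exact phi_mul_inv

theorem phi_sq : phi1 * phi1 = Iq := by
  have h1 := zt_sq
  have h2 := zt'_sq
  rw [phi_eq]
  ext i j
  fin_cases i <;> fin_cases j <;> simp [Iq] <;> grind

theorem phi_I : phi1 * Iq = Iq * phi1 := by
  rw [← phi_sq, mul_assoc]

theorem phi_J : phi1 * Jq = Kq * phi1 := by
  have h1 := zt_sq
  have h2 := zt_mul
  have h3 := zt'_sq
  have h4 := Complex.I_sq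
  rw [phi_eq, Kq_eq]
  ext i j
  fin_cases i <;> fin_cases j <;> simp [Jq] <;> grind

theorem phi_K : phi1 * Kq = (-Jq) * phi1 := by
  rw [Kq, ← mul_assoc, phi_I, mul_assoc, phi_J, ← mul_assoc]
  congr 1
  rw [Kq_eq]
  ext i j
  fin_cases i <;> fin_cases j <;> simp [Jq, Iq]

theorem conj_of {M N : Matrix (Fin 2) (Fin 2) ℂ} (h : phi1 * M = N * phi1) :
    phi1 * M * phi1⁻¹ = N := by
  rw [h, mul_assoc, phi_mul_inv, mul_one]

theorem normalizes : ∀ M ∈ binTet, phi1 * M * phi1⁻¹ ∈ binTet := by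
  have hJ := phi_J
  have hK := phi_K
  have hI := phi_I
  rintro M (h | ⟨a, ha, b, hb, c, hc, e, he, rfl⟩)
  · left
    simp only [Set.mem_insert_iff, Set.mem_singleton_iff] at h
    rcases h with rfl | rfl | rfl | rfl | rfl | rfl | rfl | rfl
    · rw [conj_of (N := 1) (by simp)]; simp
    · rw [conj_of (N := -1) (by simp)]; simp
    · rw [conj_of hI]; simp
    · rw [conj_of (N := -Iq) (by simp [hI])]; simp
    · rw [conj_of hJ]; simp
    · rw [conj_of (N := -Kq) (by simp [hJ])]; simp
    · rw [conj_of hK]; simp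
    · rw [conj_of (N := Jq) (by simp [hK])]; simp
  · right
    refine ⟨a, ha, b, hb, -e, ?_, c, hc, ?_⟩
    · rcases he with rfl | rfl <;> simp
    · apply conj_of
      simp only [mul_add, add_mul, Matrix.mul_smul, Matrix.smul_mul, hI, hJ, hK, smul_add]
      simp
      abel

theorem gen {P : Matrix (Fin 2) (Fin 2) ℂ → Prop} (hm : ∀ A B, P A → P B → P (A * B))
    (hI : P Iq) (hJ : P Jq) (ho : P om) : ∀ M ∈ binTet, P M := by
  have hII : Iq * Iq = -1 := by
    ext i j
    fin_cases i <;> fin_cases j <;> simp [Iq]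
  have hn1 : P (-1) := hII ▸ hm _ _ hI hI
  have hn : ∀ A, P A → P (-A) := fun A h => by simpa using hm _ _ hn1 h
  have h1 : P 1 := by simpa using hn _ hn1
  have hK : P Kq := hm _ _ hI hJ
  have ho2 : P (om * om) := hm _ _ ho ho
  have hIsq := Complex.I_sq
  have key : ∀ b ∈ ({1, -1} : Set ℂ), ∀ c ∈ ({1, -1} : Set ℂ), ∀ e ∈ ({1, -1} : Set ℂ),
      P ((2 : ℂ)⁻¹ • ((1 : Matrix (Fin 2) (Fin 2) ℂ) + b • Iq + c • Jq + e • Kq)) := by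
    rintro b (rfl | rfl) c (rfl | rfl) e (rfl | rfl)
    · simpa [om] using ho
    · convert hm _ _ hI (hn _ ho2) using 1
      clear hm hn h1 hn1 hI hJ hK ho ho2 hII
      rw [om_eq, Kq_eq]
      ext i j
      fin_cases i <;> fin_cases j <;> simp [Iq, Jq] <;> grind
    · convert hm _ _ hK (hn _ ho2) using 1
      clear hm hn h1 hn1 hI hJ hK ho ho2 hII
      rw [om_eq, Kq_eq]
      ext i j
      fin_cases i <;> fin_cases j <;> simp [Iq, Jq] <;> grind
    · convert hm _ _ hK (hn _ ho) using 1
      clear hm hn h1 hn1 hI hJ hK ho ho2 hII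
      rw [om_eq, Kq_eq]
      ext i j
      fin_cases i <;> fin_cases j <;> simp [Iq, Jq] <;> grind
    · convert hm _ _ hJ (hn _ ho2) using 1
      clear hm hn h1 hn1 hI hJ hK ho ho2 hII
      rw [om_eq, Kq_eq]
      ext i j
      fin_cases i <;> fin_cases j <;> simp [Iq, Jq] <;> grind
    · convert hm _ _ hI (hn _ ho) using 1
      clear hm hn h1 hn1 hI hJ hK ho ho2 hII
      rw [om_eq, Kq_eq]
      ext i j
      fin_cases i <;> fin_cases j <;> simp [Iq, Jq] <;> grind
    · convert hm _ _ hJ (hn _ ho) using 1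
      clear hm hn h1 hn1 hI hJ hK ho ho2 hII
      rw [om_eq, Kq_eq]
      ext i j
      fin_cases i <;> fin_cases j <;> simp [Iq, Jq] <;> grind
    · convert hn _ ho2 using 1
      clear hm hn h1 hn1 hI hJ hK ho ho2 hII
      rw [om_eq, Kq_eq]
      ext i j
      fin_cases i <;> fin_cases j <;> simp [Iq, Jq] <;> grind
  rintro M (h | ⟨a, ha, b, hb, c, hc, e, he, rfl⟩)
  · simp only [Set.mem_insert_iff, Set.mem_singleton_iff] at h
    rcases h with rfl | rfl | rfl | rfl | rfl | rfl | rfl | rfl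
    · exact h1
    · exact hn1
    · exact hI
    · exact hn _ hI
    · exact hJ
    · exact hn _ hJ
    · exact hK
    · exact hn _ hK
  · rcases ha with rfl | rfl
    · simpa using key b hb c hc e he
    · have hb' : -b ∈ ({1, -1} : Set ℂ) := by rcases hb with rfl | rfl <;> simp
      have hc' : -c ∈ ({1, -1} : Set ℂ) := by rcases hc with rfl | rfl <;> simp
      have he' : -e ∈ ({1, -1} : Set ℂ) := by rcases he with rfl | rfl <;> simp
      convert hn _ (key _ hb' _ hc' _ he') using 1
      rw [← smul_neg]
      congr 1
      simp only [neg_smul, one_smul]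
      abel

theorem I_mem : Iq ∈ binTet := by left; simp
theorem nI_mem : -Iq ∈ binTet := by left; simp
theorem J_mem : Jq ∈ binTet := by left; simp
theorem om_mem : om ∈ binTet := by
  right
  exact ⟨1, by simp, 1, by simp, 1, by simp, 1, by simp, by simp [om]⟩

theorem I_X0 : mact Iq (X 0) = - (C Complex.I * X 0) := by
  rw [mact_X _ _ Iinv]; simp
theorem I_X1 : mact Iq (X 1) = C Complex.I * X 1 := by
  rw [mact_X _ _ Iinv]; simp
theorem J_X0 : mact Jq (X 0) = X 1 := by
  rw [mact_X _ _ Jinv]; simp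
theorem J_X1 : mact Jq (X 1) = - X 0 := by
  rw [mact_X _ _ Jinv]; simp
theorem P_X0 : mact phi1 (X 0) = C zt' * X 0 := by
  rw [mact_X _ _ phinv]; simp
theorem P_X1 : mact phi1 (X 1) = C zt * X 1 := by
  rw [mact_X _ _ phinv]; simp
noncomputable def sg : ℂ := (1 - Complex.I) / 2

theorem sg_sq : sg ^ 4 = -1/4 := by
  have := Complex.I_sq
  have h : sg ^ 2 = - Complex.I / 2 := by rw [sg]; grind
  rw [show sg ^ 4 = (sg ^ 2) ^ 2 by ring, h]
  grind

theorem om_X0 : mact om (X 0) = C sg * (X 0 + C Complex.I * X 1) := by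
  rw [mact_X _ _ ominv, mul_add, ← mul_assoc, ← C_mul]
  congr 3
  have := Complex.I_sq
  simp [sg]; grind
theorem om_X1 : mact om (X 1) = C sg * (- X 0 + C Complex.I * X 1) := by
  rw [mact_X _ _ ominv, mul_add, ← mul_assoc, mul_neg, ← neg_mul, ← C_mul, ← C_neg]
  have := Complex.I_sq
  congr 3
  · simp [sg]; grind
  · simp [sg]; grind

theorem CI_sq : (C Complex.I : PP) ^ 2 = -1 := by
  rw [← C_pow, Complex.I_sq]; simp

theorem Csg2 : 2 * (C sg : PP) ^ 2 = - C Complex.I := by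
  have := Complex.I_sq
  rw [← C_pow, show (2 : PP) = C 2 from rfl, ← C_mul, ← C_neg]
  congr 1
  rw [sg]; grind

theorem Csg : 4 * (C sg : PP) ^ 4 = -1 := by
  rw [← C_pow, sg_sq, show (4 : PP) = C 4 from rfl, ← C_mul]; norm_num

noncomputable def tp : PP := X 0 ^ 5 * X 1 - X 0 * X 1 ^ 5
noncomputable def wp : PP := X 0 ^ 8 + 14 * X 0 ^ 4 * X 1 ^ 4 + X 1 ^ 8
noncomputable def cp : PP := X 0 ^ 12 - 33 * X 0 ^ 8 * X 1 ^ 4 - 33 * X 0 ^ 4 * X 1 ^ 8 + X 1 ^ 12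

theorem Cz1 : (C zt : PP) * C zt' = 1 := by
  rw [← C_mul, zt_mul]; simp
theorem Cz4 : (C zt : PP) ^ 4 = -1 := by
  rw [← C_pow, show zt ^ 4 = (zt^2)^2 by ring, zt_sq, Complex.I_sq]; simp
theorem Cz4' : (C zt' : PP) ^ 4 = -1 := by
  rw [← C_pow, show zt' ^ 4 = (zt'^2)^2 by ring, zt'_sq, neg_sq, Complex.I_sq]; simp

structure inE (e : ℂ) (d : ℕ) (f : PP) : Prop where
  hom : f.IsHomogeneous d
  hI : mact Iq f = f
  hJ : mact Jq f = f
  ho : mact om f = f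
  hP : mact phi1 f = C e * f

theorem inE.mul {e e' : ℂ} {d d' : ℕ} {f g : PP} (hf : inE e d f) (hg : inE e' d' g) :
    inE (e * e') (d + d') (f * g) where
  hom := hf.hom.mul hg.hom
  hI := by rw [map_mul, hf.hI, hg.hI]
  hJ := by rw [map_mul, hf.hJ, hg.hJ]
  ho := by rw [map_mul, hf.ho, hg.ho]
  hP := by rw [map_mul, hf.hP, hg.hP, C_mul]; ring

theorem t_E : inE (-1) 6 tp where
  hom := by
    apply IsHomogeneous.sub
    · exact (isHomogeneous_X_pow 0 5).mul (isHomogeneous_X _ 1)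
    · exact (isHomogeneous_X _ 0).mul (isHomogeneous_X_pow 1 5)
  hI := by
    have := CI_sq
    simp only [tp, map_mul, map_sub, map_pow, I_X0, I_X1]
    grind
  hJ := by
    simp only [tp, map_mul, map_sub, map_pow, J_X0, J_X1]
    ring
  ho := by
    have h1 := CI_sq
    have h2 := Csg2
    simp only [tp, map_mul, map_sub, map_pow, om_X0, om_X1]
    generalize (C sg : PP) = s at *
    generalize (C Complex.I : PP) = j at *
    generalize (X 0 : PP) = x at *
    generalize (X 1 : PP) = y at *
    grind
  hP := by
    have h1 := Cz1
    have h2 := Cz4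
    have h3 := Cz4'
    simp only [tp, map_mul, map_sub, map_pow, P_X0, P_X1, C_neg, C_1]
    generalize (C zt : PP) = s at *
    generalize (C zt' : PP) = j at *
    linear_combination ((X 0 : PP)^5 * X 1 * j ^ 4 - X 0 * X 1 ^ 5 * s ^ 4) * h1 +
      (X 0 ^ 5 * X 1) * h3 - X 0 * X 1 ^ 5 * h2

theorem w_E : inE 1 8 wp where
  hom := by
    apply IsHomogeneous.add (IsHomogeneous.add _ _)
    · exact (isHomogeneous_X_pow 1 8)
    · exact (isHomogeneous_X_pow 0 8)
    · rw [mul_assoc]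
      exact ((isHomogeneous_X_pow 0 4).mul (isHomogeneous_X_pow 1 4)).C_mul 14
  hI := by
    have := CI_sq
    simp only [wp, map_mul, map_add, map_pow, I_X0, I_X1, map_ofNat]
    grind
  hJ := by
    simp only [wp, map_mul, map_add, map_pow, J_X0, J_X1, map_ofNat]
    ring
  ho := by
    have h1 := CI_sq
    have h2 := Csg
    simp only [wp, map_mul, map_add, map_pow, om_X0, om_X1, map_ofNat]
    generalize (C sg : PP) = s at *
    generalize (C Complex.I : PP) = j at *
    generalize (X 0 : PP) = x at *
    generalize (X 1 : PP) = y at *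
    grind
  hP := by
    have h2 := Cz4
    have h3 := Cz4'
    simp only [wp, map_mul, map_add, map_pow, P_X0, P_X1, map_ofNat, C_1]
    generalize (C zt : PP) = s at *
    generalize (C zt' : PP) = j at *
    grind

theorem c_hom : cp.IsHomogeneous 12 := by
  have h1 : ((X 0 : PP) ^ 12).IsHomogeneous 12 := isHomogeneous_X_pow 0 12
  have h2 : ((X 1 : PP) ^ 12).IsHomogeneous 12 := isHomogeneous_X_pow 1 12
  have h3 : ((33 : PP) * X 0 ^ 8 * X 1 ^ 4).IsHomogeneous 12 := by
    rw [mul_assoc]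
    exact ((isHomogeneous_X_pow 0 8).mul (isHomogeneous_X_pow 1 4)).C_mul 33
  have h4 : ((33 : PP) * X 0 ^ 4 * X 1 ^ 8).IsHomogeneous 12 := by
    rw [mul_assoc]
    exact ((isHomogeneous_X_pow 0 4).mul (isHomogeneous_X_pow 1 8)).C_mul 33
  exact ((h1.sub h3).sub h4).add h2

theorem c_om : mact om cp = cp := by
  have h1 := CI_sq
  have h2 := Csg
  simp only [cp, map_mul, map_add, map_sub, map_pow, om_X0, om_X1, map_ofNat]
  generalize (C sg : PP) = s at *
  generalize (C Complex.I : PP) = j at *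
  generalize (X 0 : PP) = x at *
  generalize (X 1 : PP) = y at *
  grind

theorem c_E : inE (-1) 12 cp where
  hom := c_hom
  hI := by
    have := CI_sq
    simp only [cp, map_mul, map_add, map_sub, map_pow, I_X0, I_X1, map_ofNat]
    grind
  hJ := by
    simp only [cp, map_mul, map_add, map_sub, map_pow, J_X0, J_X1, map_ofNat]
    ring
  ho := c_om
  hP := by
    have h2 := Cz4
    have h3 := Cz4'
    simp only [cp, map_mul, map_add, map_sub, map_pow, P_X0, P_X1, map_ofNat, C_1, C_neg]
    generalize (C zt : PP) = s at *
    generalize (C zt' : PP) = j at *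
    grind

theorem hom_sum {f : PP} {d : ℕ} (h : f.IsHomogeneous d) :
    ∃ a : ℕ → ℂ, f = ∑ k ∈ Finset.range (d + 1), C (a k) * X 0 ^ k * X 1 ^ (d - k) := by
  refine ⟨fun k => coeff (Finsupp.single 0 k + Finsupp.single 1 (d - k)) f, ?_⟩
  have hmon : ∀ (k l : ℕ) (c : ℂ), (C c * X 0 ^ k * X 1 ^ l : PP) =
      monomial (Finsupp.single 0 k + Finsupp.single 1 l) c := by
    intro k l c
    rw [X_pow_eq_monomial, X_pow_eq_monomial, mul_assoc, monomial_mul, C_mul_monomial]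
    simp
  ext m
  simp only [hmon, coeff_sum, coeff_monomial]
  by_cases hm : m.degree = d
  · have hm' : m 0 + m 1 = d := by
      rw [← hm, Finsupp.degree_eq_sum]; simp
    have hmm : Finsupp.single 0 (m 0) + Finsupp.single 1 (d - m 0) = m := by
      ext i
      fin_cases i
      · simp
      · simp; omega
    rw [Finset.sum_eq_single (m 0)]
    · rw [if_pos hmm, hmm]
    · intro k _ hk
      rw [if_neg]
      rintro rfl
      simp at hk
    · intro h
      exfalso
      apply h
      rw [Finset.mem_range]; omega
  · rw [h.coeff_eq_zero hm, Finset.sum_eq_zero]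
    intro k hk
    rw [if_neg]
    rintro rfl
    apply hm
    rw [Finset.mem_range] at hk
    rw [Finsupp.degree_eq_sum]
    simp; omega

theorem hom_split {f : PP} {d : ℕ} (h : f.IsHomogeneous d) :
    ∃ g, f = C (eval ![0, 1] f) * X 1 ^ d + X 0 * g := by
  obtain ⟨a, ha⟩ := hom_sum h
  rw [Finset.sum_range_succ'] at ha
  have h0 : eval ![0, 1] f = a 0 := by
    rw [ha]; simp
  refine ⟨∑ k ∈ Finset.range d, C (a (k+1)) * X 0 ^ k * X 1 ^ (d - (k+1)), ?_⟩
  rw [h0]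
  conv_lhs => rw [ha]
  rw [Finset.mul_sum, add_comm]
  congr 1
  · simp
  · apply Finset.sum_congr rfl
    intro k _
    ring

theorem mact_one (f : PP) : mact 1 f = f := by
  have : mact 1 = AlgHom.id ℂ PP := by
    apply MvPolynomial.algHom_ext
    intro i
    rw [mact_X 1 1 (by simp)]
    fin_cases i <;> simp [Matrix.one_apply]
  rw [this]; rfl

theorem mact_prime {A B : Matrix (Fin 2) (Fin 2) ℂ} (h : A * B = 1) {p : PP} (hp : Prime p) :
    Prime (mact A p) := by
  let e : PP ≃ₐ[ℂ] PP := AlgEquiv.ofAlgHom (mact A) (mact B)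
    (by ext1 i; simp only [AlgHom.comp_apply, ← mact_mul, h, mact_one]; rfl)
    (by ext1 i; simp only [AlgHom.comp_apply, ← mact_mul, mul_eq_one_comm.mp h, mact_one]; rfl)
  have := (MulEquiv.prime_iff e.toMulEquiv).2 hp
  exact this

theorem stepd {p q f : PP} (v : Fin 2 → ℂ) (hp : Prime p) (h0 : eval v p = 0)
    (h1 : eval v q ≠ 0) (hpf : p ∣ f) (hqf : q ∣ f) : q * p ∣ f := by
  obtain ⟨g, rfl⟩ := hqf
  rcases hp.dvd_or_dvd hpf with h | h
  · obtain ⟨r, rfl⟩ := h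
    simp [h0] at h1
  · exact mul_dvd_mul_left q h

theorem sg_ne : sg ≠ 0 := by
  intro h
  have := sg_sq
  rw [h] at this
  norm_num at this

theorem t_dvd {e : ℂ} {d : ℕ} {f : PP} (hf : inE e d f) (h0 : eval ![0, 1] f = 0) : tp ∣ f := by
  have hx : (X 0 : PP) ∣ f := by
    obtain ⟨g, hg⟩ := hom_split hf.hom
    rw [h0] at hg
    exact ⟨g, by simpa using hg⟩
  have hI2 := Complex.I_sq
  have hy : (X 1 : PP) ∣ f := by
    have := map_dvd (mact Jq) hx
    rwa [hf.hJ, J_X0] at this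
  have h3 : mact om (X 0) ∣ f := by
    have := map_dvd (mact om) hx
    rwa [hf.ho] at this
  have h4 : mact om (X 1) ∣ f := by
    have := map_dvd (mact om) hy
    rwa [hf.ho] at this
  have h5 : mact om (mact om (X 0)) ∣ f := by
    have := map_dvd (mact om) h3
    rwa [hf.ho] at this
  have h6 : mact om (mact om (X 1)) ∣ f := by
    have := map_dvd (mact om) h4
    rwa [hf.ho] at this
  have p1 : Prime (X 0 : PP) := X_prime
  have p2 : Prime (X 1 : PP) := X_prime
  have p3 := mact_prime ominv p1
  have p4 := mact_prime ominv p2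
  have p5 := mact_prime ominv p3
  have p6 := mact_prime ominv p4
  have e3 : mact om (X 0) = C sg * (X 0 + C Complex.I * X 1) := om_X0
  have e4 : mact om (X 1) = C sg * (- X 0 + C Complex.I * X 1) := om_X1
  have e5 : mact om (mact om (X 0)) = C (sg ^ 2 * (1 - Complex.I)) * (X 0 - X 1) := by
    have := CI_sq
    rw [e3, map_mul, map_add, map_mul, e3, e4]
    simp only [algHom_C, algebraMap_eq, C_mul, C_pow, C_sub, C_1]
    grind
  have e6 : mact om (mact om (X 1)) = C (- sg ^ 2 * (1 + Complex.I)) * (X 0 + X 1) := by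
    have := CI_sq
    rw [e4, map_mul, map_add, map_mul, map_neg, e3, e4]
    simp only [algHom_C, algebraMap_eq, C_mul, C_pow, C_add, C_1, C_neg]
    grind
  rw [e3] at h3 p3
  rw [e4] at h4 p4
  rw [e5] at h5 p5
  rw [e6] at h6 p6
  have hs := sg_ne
  have hIn : Complex.I ≠ 0 := Complex.I_ne_zero
  have hI1 : (1 - Complex.I) ≠ 0 := by intro h; grind
  have hI3 : (1 + Complex.I) ≠ 0 := by intro h; grind
  have q2 := stepd ![1, 0] p2 (by simp) (by simp) hy hx
  have q3 := stepd ![-Complex.I, 1] p3 (by simp) (by simp) h3 q2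
  have q4 := stepd ![Complex.I, 1] p4 (by simp) (by simp [hs]) h4 q3
  have q5 := stepd ![1, 1] p5 (by simp) (by
    simp [hs, hI3]; intro h; grind) h5 q4
  have q6 := stepd ![-1, 1] p6 (by simp) (by
    simp [hs, hI1, hI3]; constructor
    · intro h; grind
    · norm_num) h6 q5
  refine dvd_trans ⟨C (Complex.I / 4), ?_⟩ q6
  have h1 := CI_sq
  have h2 := Csg2
  have hr : 4 * (C (Complex.I / 4) : PP) = C Complex.I := by
    rw [show (4 : PP) = C 4 from rfl, ← C_mul]
    congr 1; ring
  simp only [tp, C_mul, C_pow, C_add, C_sub, C_1, C_neg]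
  generalize (C (Complex.I / 4) : PP) = r at *
  generalize (C sg : PP) = s at *
  generalize (C Complex.I : PP) = j at *
  generalize (X 0 : PP) = x at *
  generalize (X 1 : PP) = y at *
  clear * - h1 h2 hr
  grind

theorem tp_ne : tp ≠ 0 := by
  intro h
  have := congrArg (eval ![2, 1]) h
  simp [tp] at this
  norm_num at this

theorem comp_mul (d : ℕ) (g : PP) :
    homogeneousComponent (d + 6) (tp * g) = tp * homogeneousComponent d g := by
  conv_lhs => rw [← sum_homogeneousComponent g, Finset.mul_sum, map_sum]
  have : ∀ i, homogeneousComponent (d + 6) (tp * homogeneousComponent i g) =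
      if i = d then tp * homogeneousComponent d g else 0 := by
    intro i
    rw [homogeneousComponent_of_mem (m := d + 6) (n := 6 + i)
      (t_E.hom.mul (homogeneousComponent_isHomogeneous i g))]
    by_cases h : i = d
    · subst h; simp [add_comm]
    · rw [if_neg (by omega), if_neg h]
  simp only [this, Finset.sum_ite_eq', Finset.mem_range]
  split_ifs with h
  · rfl
  · rw [homogeneousComponent_eq_zero _ _ (by omega), mul_zero]

theorem comp_mul_lt (d : ℕ) (hd : d < 6) (g : PP) :
    homogeneousComponent d (tp * g) = 0 := by
  conv_lhs => rw [← sum_homogeneousComponent g, Finset.mul_sum, map_sum]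
  apply Finset.sum_eq_zero
  intro i _
  rw [homogeneousComponent_of_mem (m := d) (n := 6 + i)
      (t_E.hom.mul (homogeneousComponent_isHomogeneous i g)), if_neg (by omega)]

theorem div_lt {e : ℂ} {d : ℕ} {f : PP} (hd : d < 6) (hf : inE e d f)
    (h0 : eval ![0, 1] f = 0) : f = 0 := by
  obtain ⟨g, hg⟩ := t_dvd hf h0
  have := comp_mul_lt d hd g
  rw [← hg] at this
  rwa [homogeneousComponent_eq_self hf.hom] at this

theorem div_ge {e : ℂ} {d : ℕ} {f : PP} (hf : inE e (d + 6) f)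
    (h0 : eval ![0, 1] f = 0) : ∃ g, inE (-e) d g ∧ f = tp * g := by
  obtain ⟨g', hg⟩ := t_dvd hf h0
  have h := comp_mul d g'
  rw [← hg, homogeneousComponent_eq_self hf.hom] at h
  refine ⟨homogeneousComponent d g', ?_, h⟩
  have hh := homogeneousComponent_isHomogeneous d g'
  generalize homogeneousComponent d g' = g at *
  subst h
  constructor
  · exact hh
  · have := hf.hI; rw [map_mul, t_E.hI] at this; exact mul_left_cancel₀ tp_ne this
  · have := hf.hJ; rw [map_mul, t_E.hJ] at this; exact mul_left_cancel₀ tp_ne this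
  · have := hf.ho; rw [map_mul, t_E.ho] at this; exact mul_left_cancel₀ tp_ne this
  · have := hf.hP
    rw [map_mul, t_E.hP] at this
    apply mul_left_cancel₀ tp_ne
    simp only [C_neg, C_1] at this ⊢
    linear_combination -this

noncomputable def EE (e : ℂ) (d : ℕ) : Submodule ℂ PP where
  carrier := {f | inE e d f}
  zero_mem' := ⟨isHomogeneous_zero _ _ _, by simp, by simp, by simp, by simp⟩
  add_mem' {f g} hf hg := ⟨hf.hom.add hg.hom, by rw [map_add, hf.hI, hg.hI],
    by rw [map_add, hf.hJ, hg.hJ], by rw [map_add, hf.ho, hg.ho],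
    by rw [map_add, hf.hP, hg.hP, mul_add]⟩
  smul_mem' c f hf := ⟨by rw [smul_eq_C_mul]; exact hf.hom.C_mul c, by rw [map_smul, hf.hI],
    by rw [map_smul, hf.hJ], by rw [map_smul, hf.ho],
    by rw [map_smul, hf.hP, mul_smul_comm]⟩

theorem mem_EE {e : ℂ} {d : ℕ} {f : PP} : f ∈ EE e d ↔ inE e d f := Iff.rfl

instance (e : ℂ) (d : ℕ) : FiniteDimensional ℂ (EE e d) := by
  have : FiniteDimensional ℂ (homogeneousSubmodule (Fin 2) ℂ d) :=
    Module.Finite.iff_fg.2 (homogeneousSubmodule_fg _ _ d)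
  exact Submodule.finiteDimensional_of_le (S₂ := homogeneousSubmodule (Fin 2) ℂ d)
    (fun f hf => (mem_EE.1 hf).hom)

noncomputable def LL (e : ℂ) (d : ℕ) : EE e d →ₗ[ℂ] ℂ :=
  (MvPolynomial.aeval (R := ℂ) (![0, 1] : Fin 2 → ℂ)).toLinearMap ∘ₗ (EE e d).subtype

theorem LL_apply {e : ℂ} {d : ℕ} (f : EE e d) : LL e d f = eval ![0, 1] (f : PP) := by
  simp [LL, MvPolynomial.coe_aeval_eq_eval]

noncomputable def MM (e : ℂ) (d : ℕ) : EE (-e) d →ₗ[ℂ] EE e (d + 6) where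
  toFun g := ⟨tp * g, by
    have := t_E.mul (mem_EE.1 g.2)
    rw [mem_EE]
    convert this using 1
    · ring
    · ring⟩
  map_add' f g := by ext1; simp [mul_add]
  map_smul' c f := by ext1; simp

theorem ker_eq (e : ℂ) (d : ℕ) : LinearMap.ker (LL e (d + 6)) = LinearMap.range (MM e d) := by
  ext f
  rw [LinearMap.mem_ker, LinearMap.mem_range, LL_apply]
  constructor
  · intro h
    obtain ⟨g, hg, hfg⟩ := div_ge (mem_EE.1 f.2) h
    exact ⟨⟨g, hg⟩, Subtype.ext hfg.symm⟩
  · rintro ⟨g, rfl⟩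
    simp [MM, tp]

theorem MM_inj (e : ℂ) (d : ℕ) : Function.Injective (MM e d) := by
  intro f g h
  have := congrArg Subtype.val h
  exact Subtype.ext (mul_left_cancel₀ tp_ne this)

theorem rank_ge (e : ℂ) (d : ℕ) : Module.finrank ℂ (EE e (d + 6)) =
    Module.finrank ℂ (LinearMap.range (LL e (d + 6))) + Module.finrank ℂ (EE (-e) d) := by
  rw [← LinearMap.finrank_range_add_finrank_ker (LL e (d + 6)), ker_eq,
    LinearMap.finrank_range_of_inj (MM_inj e d)]

theorem rank_lt (e : ℂ) (d : ℕ) (hd : d < 6) : Module.finrank ℂ (EE e d) =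
    Module.finrank ℂ (LinearMap.range (LL e d)) := by
  symm
  apply LinearMap.finrank_range_of_inj
  rw [← LinearMap.ker_eq_bot, LinearMap.ker_eq_bot']
  intro f hf
  rw [LL_apply] at hf
  exact Subtype.ext (div_lt hd (mem_EE.1 f.2) hf)

theorem range_one {e : ℂ} {d : ℕ} {f : PP} (hf : inE e d f) (h : eval ![0, 1] f ≠ 0) :
    Module.finrank ℂ (LinearMap.range (LL e d)) = 1 := by
  have : LinearMap.range (LL e d) = ⊤ := by
    rw [LinearMap.range_eq_top]
    apply LinearMap.surjective
    intro h0
    apply h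
    have := congrArg (fun l => l ⟨f, hf⟩) h0
    simpa [LL_apply] using this
  rw [this, finrank_top, Module.finrank_self]

theorem range_zero {e : ℂ} {d : ℕ} (h : ∀ f, inE e d f → eval ![0, 1] f = 0) :
    Module.finrank ℂ (LinearMap.range (LL e d)) = 0 := by
  have : LL e d = 0 := by
    ext f
    rw [LL_apply]
    exact h _ f.2
  rw [this, LinearMap.range_zero, finrank_bot]

theorem ev_ne {e : ℂ} {d : ℕ} {f : PP} (hf : inE e d f) (h : eval ![0, 1] f ≠ 0) :
    zt ^ d = e := by
  obtain ⟨g, hg⟩ := hom_split hf.hom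
  have h1 := congrArg (eval ![0, 1]) hf.hP
  rw [hg] at h1
  simp only [map_mul, map_add, map_pow, P_X0, P_X1] at h1
  simp at h1
  apply mul_right_cancel₀ h
  rw [mul_comm]
  exact h1

theorem zt_pow (n : ℕ) : zt ^ (2 * n) = Complex.I ^ (n % 4) := by
  rw [pow_mul, zt_sq, Complex.I_pow_eq_pow_mod]

theorem I_ne_one : Complex.I ≠ 1 := by
  intro h; have := congrArg Complex.re h; simp at this
theorem I_ne_neg_one : Complex.I ≠ -1 := by
  intro h; have := congrArg Complex.re h; simp at this

theorem mod_pos {n : ℕ} {f : PP} (hf : inE 1 (2 * n) f) (h : eval ![0, 1] f ≠ 0) : n % 4 = 0 := by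
  have h1 := ev_ne hf h
  have h2 := I_ne_one
  have h3 := I_ne_neg_one
  have h4 := Complex.I_sq
  rw [zt_pow] at h1
  have : n % 4 < 4 := Nat.mod_lt _ (by norm_num)
  interval_cases n % 4
  · rfl
  all_goals exfalso; grind

theorem mod_neg {n : ℕ} {f : PP} (hf : inE (-1) (2 * n) f) (h : eval ![0, 1] f ≠ 0) :
    n % 4 = 2 := by
  have h1 := ev_ne hf h
  have h2 := I_ne_one
  have h3 := I_ne_neg_one
  have h4 := Complex.I_sq
  rw [zt_pow] at h1
  have : n % 4 < 4 := Nat.mod_lt _ (by norm_num)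
  interval_cases n % 4
  · exfalso; grind
  · exfalso; grind
  · rfl
  · exfalso; grind

theorem eval_mact (A : Matrix (Fin 2) (Fin 2) ℂ) (v : Fin 2 → ℂ) (f : PP) :
    eval v (mact A f) = eval (fun i => eval v (mact A (X i))) f := by
  have : (MvPolynomial.aeval v).comp (mact A) =
      MvPolynomial.aeval (fun i => eval v (mact A (X i))) := by
    apply MvPolynomial.algHom_ext
    intro i
    simp [MvPolynomial.coe_aeval_eq_eval]
  have := congrArg (fun l => l f) this
  simpa [MvPolynomial.coe_aeval_eq_eval] using this

theorem four {e : ℂ} {f : PP} (hf : inE e 4 f) : eval ![0, 1] f = 0 := by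
  obtain ⟨a, ha⟩ := hom_sum hf.hom
  have hev : ∀ v : Fin 2 → ℂ, eval v f = a 0 * v 1 ^ 4 + a 1 * v 0 * v 1 ^ 3
      + a 2 * v 0 ^ 2 * v 1 ^ 2 + a 3 * v 0 ^ 3 * v 1 + a 4 * v 0 ^ 4 := by
    intro v
    rw [ha]
    simp [Finset.sum_range_succ]
  have ho : ∀ v : Fin 2 → ℂ, eval ![sg * (v 0 + Complex.I * v 1), sg * (- v 0 + Complex.I * v 1)] f
      = eval v f := by
    intro v
    conv_rhs => rw [← hf.ho, eval_mact]
    congr 2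
    ext i
    fin_cases i <;> simp [om_X0, om_X1]
  have hJ : eval ![1, 0] f = eval ![0, 1] f := by
    conv_rhs => rw [← hf.hJ, eval_mact]
    congr 2
    ext i
    fin_cases i <;> simp [J_X0, J_X1]
  have h1 := ho ![0, 1]
  have h2 := ho ![1, 0]
  have h3 := ho ![sg * (Complex.I * 1), sg * (Complex.I * 1)]
  have h4 := ho ![sg, - sg]
  simp only [hev] at h1 h2 h3 h4 hJ ⊢
  simp at h1 h2 h3 h4 hJ ⊢
  have hs : 2 * sg ^ 2 = - Complex.I := by
    have := Complex.I_sq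
    rw [sg]; grind
  have hI := Complex.I_sq
  generalize sg = s at *
  generalize Complex.I = j at *
  clear * - h1 h2 h3 h4 hJ hs hI
  grind

theorem w_pow (k : ℕ) : inE 1 (8 * k) (wp ^ k) := by
  induction k with
  | zero => exact ⟨by simpa using isHomogeneous_one _ _, by simp, by simp, by simp, by simp⟩
  | succ k ih =>
    have := ih.mul w_E
    rw [pow_succ]
    convert this using 1
    · simp
    · ring

theorem ev_w : eval ![0, 1] wp = 1 := by simp [wp]
theorem ev_c : eval ![0, 1] cp = 1 := by simp [cp]

theorem range_pos (n : ℕ) : Module.finrank ℂ (LinearMap.range (LL 1 (2 * n))) =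
    if n % 4 = 0 then 1 else 0 := by
  split_ifs with h
  · have := w_pow (n / 4)
    rw [show 8 * (n / 4) = 2 * n by omega] at this
    exact range_one this (by simp [ev_w])
  · apply range_zero
    intro f hf
    by_contra h0
    exact h (mod_pos hf h0)

theorem range_neg (n : ℕ) : Module.finrank ℂ (LinearMap.range (LL (-1) (2 * n))) =
    if n % 4 = 2 ∧ n ≠ 2 then 1 else 0 := by
  split_ifs with h
  · have := c_E.mul (w_pow ((n - 6) / 4))
    rw [show 12 + 8 * ((n - 6) / 4) = 2 * n by omega, mul_one] at this
    exact range_one this (by simp [ev_w, ev_c])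
  · apply range_zero
    intro f hf
    by_contra h0
    have := mod_neg hf h0
    have h2 : n = 2 := by tauto
    subst h2
    exact h0 (four hf)

theorem ranks (n : ℕ) : (Module.finrank ℂ (EE 1 (2 * n)), Module.finrank ℂ (EE (-1) (2 * n))) =
    if (2 * n) % 8 = 0 then ((2 * n) / 24 + 1, (2 * n) / 24)
    else if (2 * n) % 8 = 6 then ((2 * n) / 24, (2 * n) / 24 + 1)
    else if (2 * n) % 24 = 2 ∨ (2 * n) % 24 = 4 ∨ (2 * n) % 24 = 10 then
      ((2 * n) / 24, (2 * n) / 24)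
    else ((2 * n) / 24 + 1, (2 * n) / 24 + 1) := by
  induction n using Nat.strong_induction_on with
  | _ n ih =>
    by_cases hn : n < 3
    · rw [rank_lt _ _ (by omega), rank_lt _ _ (by omega), range_pos, range_neg]
      interval_cases n <;> simp
    · obtain ⟨m, rfl⟩ : ∃ m, n = m + 3 := ⟨n - 3, by omega⟩
      have h := ih m (by omega)
      have e1 := rank_ge 1 (2 * m)
      have e2 := rank_ge (-1) (2 * m)
      rw [show 2 * m + 6 = 2 * (m + 3) by ring, range_pos] at e1
      rw [show 2 * m + 6 = 2 * (m + 3) by ring, range_neg, neg_neg] at e2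
      rw [e1, e2]
      generalize Module.finrank ℂ (EE 1 (2 * m)) = a at *
      generalize Module.finrank ℂ (EE (-1) (2 * m)) = b at *
      clear ih e1 e2
      split_ifs at h ⊢ <;> simp only [Prod.mk.injEq] at h ⊢ <;> omega

theorem mem_inv {S : Set (Matrix (Fin 2) (Fin 2) ℂ)} {d : ℕ} {f : PP} :
    f ∈ invariants S d ↔ f.IsHomogeneous d ∧ ∀ A ∈ S, mact A f = f := by
  simp [invariants, LinearMap.mem_eqLocus]

theorem phi_pres {d : ℕ} : ∀ x ∈ invariants binTet d,
    (mact phi1).toLinearMap x ∈ invariants binTet d := by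
  intro f hf
  rw [mem_inv] at hf ⊢
  obtain ⟨h1, h2⟩ := hf
  refine ⟨mact_hom _ h1, ?_⟩
  intro M hM
  have hinv : phi1 * (-Iq) = phi1⁻¹ := by
    symm
    apply Matrix.inv_eq_right_inv
    rw [← mul_assoc, phi_sq]
    ext i j
    fin_cases i <;> fin_cases j <;> simp [Iq]
  have hp : mact phi1 f = mact phi1⁻¹ f := by
    rw [← hinv, mact_mul, h2 _ nI_mem]
  have : M * phi1⁻¹ = phi1⁻¹ * (phi1 * M * phi1⁻¹) := by
    rw [← mul_assoc, ← mul_assoc, phi_inv_mul, one_mul]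
  change mact M (mact phi1 f) = mact phi1 f
  rw [hp, ← mact_mul, this, mact_mul, h2 _ (normalizes M hM)]

theorem eig_map {d : ℕ} (h : ∀ x ∈ invariants binTet d,
    (mact phi1).toLinearMap x ∈ invariants binTet d) (e : ℂ) :
    Module.finrank ℂ
      (Module.End.eigenspace (LinearMap.restrict (mact phi1).toLinearMap h) e) =
    Module.finrank ℂ (EE e d) := by
  rw [← Submodule.finrank_map_subtype_eq]
  suffices hs : Submodule.map (invariants binTet d).subtype
      (Module.End.eigenspace ((mact phi1).toLinearMap.restrict h) e) = EE e d by rw [hs]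
  ext f
  rw [Submodule.mem_map, mem_EE]
  constructor
  · rintro ⟨⟨g, hg⟩, hge, rfl⟩
    rw [Module.End.mem_eigenspace_iff] at hge
    have h1 := mem_inv.1 hg
    refine ⟨h1.1, h1.2 _ I_mem, h1.2 _ J_mem, h1.2 _ om_mem, ?_⟩
    have := congrArg Subtype.val hge
    rw [← smul_eq_C_mul]
    exact this
  · intro hf
    have hfi : f ∈ invariants binTet d := by
      rw [mem_inv]
      refine ⟨hf.hom, gen (P := fun A => mact A f = f) ?_ hf.hI hf.hJ hf.ho⟩
      intro A B hA hB
      rw [mact_mul, hB, hA]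
    refine ⟨⟨f, hfi⟩, ?_, rfl⟩
    rw [Module.End.mem_eigenspace_iff]
    apply Subtype.ext
    have := hf.hP
    rw [← smul_eq_C_mul] at this
    exact this

theorem statement9 :
    (∀ M ∈ binTet, phi1 * M * phi1⁻¹ ∈ binTet) ∧
    phi1 * phi1 ∈ binTet ∧
    ∀ d : ℕ, d % 2 = 0 →
      ∃ h : ∀ x ∈ invariants binTet d, (mact phi1).toLinearMap x ∈ invariants binTet d,
        (LinearMap.restrict (mact phi1).toLinearMap h) ∘ₗ
            (LinearMap.restrict (mact phi1).toLinearMap h) = LinearMap.id ∧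
        (Module.finrank ℂ
            (Module.End.eigenspace (LinearMap.restrict (mact phi1).toLinearMap h) 1),
         Module.finrank ℂ
            (Module.End.eigenspace (LinearMap.restrict (mact phi1).toLinearMap h) (-1))) =
          if d % 8 = 0 then (d / 24 + 1, d / 24)
          else if d % 8 = 6 then (d / 24, d / 24 + 1)
          else if d % 24 = 2 ∨ d % 24 = 4 ∨ d % 24 = 10 then (d / 24, d / 24)
          else (d / 24 + 1, d / 24 + 1) := by

  refine ⟨normalizes, by rw [phi_sq]; exact I_mem, ?_⟩
  intro d hd
  refine ⟨phi_pres, ?_, ?_⟩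
  · ext1 ⟨f, hf⟩
    apply Subtype.ext
    change mact phi1 (mact phi1 f) = f
    rw [← mact_mul, phi_sq]
    exact (mem_inv.1 hf).2 _ I_mem
  · rw [eig_map, eig_map]
    obtain ⟨n, rfl⟩ : ∃ n, d = 2 * n := ⟨d / 2, by omega⟩
    exact ranks n
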